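/- arXiv:1809.01738 — 9 statements merged into one kernel-verified Lean document; each statement's English description precedes it below -/
import Mathlib

section
/- Let θ be a real number with −m₁·D(Q‖P) − m₂·D(U‖V) ≤ θ ≤ m₁·D(P‖Q) + m₂·D(V‖U). Then the unrestricted supremum sup_{t ∈ ℝ} (t·θ − ψ_{QU}(t)) equals the restricted supremum E_{QU}(θ) = sup_{t ∈ [0,1]} (t·θ − ψ_{QU}(t)). -/
/-- KL divergence between two (positive) pmfs on a finite type. -/
noncomputable def klDiv {α : Type*} [Fintype α] (p q : α → ℝ) : ℝ :=
  ∑ x, p x * Real.log (p x / q x)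

/-- ψ_{QU}(t) = m₁·log(∑_x Q x·(P x/Q x)^t) + m₂·log(∑_y U y·(V y/U y)^t). -/
noncomputable def psiQU {α β : Type*} [Fintype α] [Fintype β]
    (P Q : α → ℝ) (V U : β → ℝ) (m₁ m₂ t : ℝ) : ℝ :=
  m₁ * Real.log (∑ x, Q x * (P x / Q x) ^ t) +
    m₂ * Real.log (∑ y, U y * (V y / U y) ^ t)

/-- E_{QU}(θ) = sup_{t∈[0,1]} (t·θ − ψ_{QU}(t)). -/
noncomputable def EQU {α β : Type*} [Fintype α] [Fintype β]
    (P Q : α → ℝ) (V U : β → ℝ) (m₁ m₂ θ : ℝ) : ℝ :=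
  sSup ((fun t : ℝ => t * θ - psiQU P Q V U m₁ m₂ t) '' Set.Icc 0 1)

open Set in
/-- If every value of `g` is dominated by a value on `s`, where `g` is bounded above, then the
supremum of `g` equals its supremum over `s`. -/
theorem iSup_eq_sSup_image_of_forall_exists_le {ι : Type*} [Nonempty ι] (g : ι → ℝ) (s : Set ι)
    (hbdd : BddAbove (g '' s)) (h : ∀ t, ∃ u ∈ s, g t ≤ g u) :
    (⨆ t, g t) = sSup (g '' s) := by
  have hle (t : ι) : g t ≤ sSup (g '' s) := by
    obtain ⟨u, hu, htu⟩ := h t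
    exact htu.trans (le_csSup hbdd (mem_image_of_mem g hu))
  refine le_antisymm (ciSup_le hle) (csSup_le ?_ ?_)
  · obtain ⟨u, hu, -⟩ := h (Classical.arbitrary ι)
    exact ⟨g u, mem_image_of_mem g hu⟩
  · rintro _ ⟨u, -, rfl⟩
    exact le_ciSup ⟨_, forall_mem_range.2 hle⟩ u

/-- Jensen's inequality for the logarithm of a weighted sum of powers. -/
theorem mul_sum_mul_log_le_log_sum_mul_rpow {α : Type*} [Fintype α] {w r : α → ℝ}
    (hw : ∀ x, 0 < w x) (hsum : ∑ x, w x = 1) (hr : ∀ x, 0 < r x) (s : ℝ) :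
    s * ∑ x, w x * Real.log (r x) ≤ Real.log (∑ x, w x * r x ^ s) := by
  have h := strictConcaveOn_log_Ioi.concaveOn.le_map_sum (t := Finset.univ) (w := w)
    (p := fun x => r x ^ s) (fun x _ => (hw x).le) hsum (fun x _ => Real.rpow_pos_of_pos (hr x) s)
  simp only [smul_eq_mul] at h
  refine le_trans (le_of_eq ?_) h
  rw [Finset.mul_sum]
  refine Finset.sum_congr rfl fun x _ => ?_
  rw [Real.log_rpow (hr x)]
  ring

theorem neg_mul_klDiv_le_log_sum {α : Type*} [Fintype α] {P Q : α → ℝ}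
    (hP : ∀ x, 0 < P x) (hQ : ∀ x, 0 < Q x) (hQsum : ∑ x, Q x = 1) (t : ℝ) :
    -(t * klDiv Q P) ≤ Real.log (∑ x, Q x * (P x / Q x) ^ t) := by
  refine le_trans (le_of_eq ?_)
    (mul_sum_mul_log_le_log_sum_mul_rpow hQ hQsum (fun x => div_pos (hP x) (hQ x)) t)
  rw [klDiv, ← mul_neg, ← Finset.sum_neg_distrib]
  congr 1
  refine Finset.sum_congr rfl fun x _ => ?_
  rw [← inv_div, Real.log_inv, mul_neg, neg_neg]

theorem sub_one_mul_klDiv_le_log_sum {α : Type*} [Fintype α] {P Q : α → ℝ}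
    (hP : ∀ x, 0 < P x) (hPsum : ∑ x, P x = 1) (hQ : ∀ x, 0 < Q x) (t : ℝ) :
    (t - 1) * klDiv P Q ≤ Real.log (∑ x, Q x * (P x / Q x) ^ t) := by
  refine (mul_sum_mul_log_le_log_sum_mul_rpow hP hPsum
    (fun x => div_pos (hP x) (hQ x)) (t - 1)).trans (le_of_eq ?_)
  congr 1
  refine Finset.sum_congr rfl fun x _ => ?_
  have hp := (hP x).ne'
  have hq := (hQ x).ne'
  rw [Real.rpow_sub_one (div_pos (hP x) (hQ x)).ne']
  field_simp

theorem psiQU_zero {α β : Type*} [Fintype α] [Fintype β] (P : α → ℝ) {Q : α → ℝ} (V : β → ℝ)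
    {U : β → ℝ} (hQsum : ∑ x, Q x = 1) (hUsum : ∑ y, U y = 1) (m₁ m₂ : ℝ) :
    psiQU P Q V U m₁ m₂ 0 = 0 := by
  simp [psiQU, hQsum, hUsum]

theorem psiQU_one {α β : Type*} [Fintype α] [Fintype β] {P Q : α → ℝ} {V U : β → ℝ}
    (hPsum : ∑ x, P x = 1) (hQ : ∀ x, 0 < Q x) (hVsum : ∑ y, V y = 1) (hU : ∀ y, 0 < U y)
    (m₁ m₂ : ℝ) : psiQU P Q V U m₁ m₂ 1 = 0 := by
  simp [psiQU, mul_div_cancel₀, (hQ _).ne', (hU _).ne', hPsum, hVsum]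

theorem sup_unrestricted_eq_restricted
    {α β : Type*} [Fintype α] [Nonempty α] [Fintype β] [Nonempty β]
    (P Q : α → ℝ) (V U : β → ℝ)
    (hP : ∀ x, 0 < P x) (hPsum : ∑ x, P x = 1)
    (hQ : ∀ x, 0 < Q x) (hQsum : ∑ x, Q x = 1)
    (hV : ∀ y, 0 < V y) (hVsum : ∑ y, V y = 1)
    (hU : ∀ y, 0 < U y) (hUsum : ∑ y, U y = 1)
    (m₁ m₂ : ℝ) (hm₁ : 0 ≤ m₁) (hm₂ : 0 ≤ m₂) (θ : ℝ)
    (hθ₁ : -(m₁ * klDiv Q P) - m₂ * klDiv U V ≤ θ)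
    (hθ₂ : θ ≤ m₁ * klDiv P Q + m₂ * klDiv V U) :
    (⨆ t : ℝ, t * θ - psiQU P Q V U m₁ m₂ t) = EQU P Q V U m₁ m₂ θ := by
  have hlower (t : ℝ) :
      -(t * (m₁ * klDiv Q P + m₂ * klDiv U V)) ≤ psiQU P Q V U m₁ m₂ t := by
    have h₁ := mul_le_mul_of_nonneg_left (neg_mul_klDiv_le_log_sum hP hQ hQsum t) hm₁
    have h₂ := mul_le_mul_of_nonneg_left (neg_mul_klDiv_le_log_sum hV hU hUsum t) hm₂
    rw [psiQU]
    linarith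
  have hlower' (t : ℝ) :
      (t - 1) * (m₁ * klDiv P Q + m₂ * klDiv V U) ≤ psiQU P Q V U m₁ m₂ t := by
    have h₁ := mul_le_mul_of_nonneg_left (sub_one_mul_klDiv_le_log_sum hP hPsum hQ t) hm₁
    have h₂ := mul_le_mul_of_nonneg_left (sub_one_mul_klDiv_le_log_sum hV hVsum hU t) hm₂
    rw [psiQU]
    linarith
  have hθ₀ : 0 ≤ θ + (m₁ * klDiv Q P + m₂ * klDiv U V) := by linarith
  refine iSup_eq_sSup_image_of_forall_exists_le
    (fun t : ℝ => t * θ - psiQU P Q V U m₁ m₂ t) (Set.Icc 0 1) ?_ fun t => ?_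
  · refine ⟨θ + (m₁ * klDiv Q P + m₂ * klDiv U V), ?_⟩
    rintro _ ⟨t, ⟨-, ht⟩, rfl⟩
    have := mul_le_mul_of_nonneg_right ht hθ₀
    linarith [hlower t]
  · rcases lt_or_ge t 0 with ht₀ | ht₀
    · refine ⟨0, by simp, ?_⟩
      have := mul_nonpos_of_nonpos_of_nonneg ht₀.le hθ₀
      simp only [psiQU_zero P V hQsum hUsum]
      linarith [hlower t]
    rcases le_or_gt t 1 with ht₁ | ht₁
    · exact ⟨t, ⟨ht₀, ht₁⟩, le_rfl⟩
    · refine ⟨1, by simp, ?_⟩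
      have := mul_le_mul_of_nonneg_left hθ₂ (sub_nonneg.2 ht₁.le)
      simp only [psiQU_one hPsum hQ hVsum hU]
      linarith [hlower' t]
end

section
/- Suppose |log(P x / Q x)| ≤ B for all x, where B ≥ 0. Then ∑_x Q x · (log(P x / Q x))² ≤ 2·e^B·D(Q‖P). -/
theorem sq_div_two_le_one_add_sub_one_mul_exp {t : ℝ} (ht : 0 ≤ t) :
    t ^ 2 / 2 ≤ 1 + (t - 1) * Real.exp t := by
  have hd (s : ℝ) : HasDerivAt (fun s : ℝ ↦ 1 + (s - 1) * Real.exp s - s ^ 2 / 2)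
      (s * (Real.exp s - 1)) s := by
    have h := (((hasDerivAt_id s).sub_const 1).mul (Real.hasDerivAt_exp s)).const_add 1 |>.sub
      (((hasDerivAt_id s).pow 2).div_const 2)
    exact h.congr_deriv (by simp; ring)
  have hmono : Monotone (fun s : ℝ ↦ 1 + (s - 1) * Real.exp s - s ^ 2 / 2) := by
    refine monotone_of_deriv_nonneg (fun s ↦ (hd s).differentiableAt) fun s ↦ ?_
    rw [(hd s).deriv]
    rcases le_total 0 s with hs | hs
    · exact mul_nonneg hs (sub_nonneg.2 (Real.one_le_exp hs))
    · exact mul_nonneg_of_nonpos_of_nonpos hs (sub_nonpos.2 (Real.exp_le_one_iff.2 hs))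
  have h := hmono ht
  simp only [Real.exp_zero] at h
  linarith

theorem sq_le_two_mul_exp_mul_exp_sub_one_sub {z B : ℝ} (hz : |z| ≤ B) :
    z ^ 2 ≤ 2 * Real.exp B * (Real.exp z - 1 - z) := by
  have hnonneg : 0 ≤ Real.exp z - 1 - z := by linarith [Real.add_one_le_exp z]
  suffices h : z ^ 2 ≤ 2 * Real.exp |z| * (Real.exp z - 1 - z) from
    h.trans (by gcongr)
  rcases le_total 0 z with h0 | h0
  · have h1 := Real.quadratic_le_exp_of_nonneg h0
    have h2 := mul_le_mul_of_nonneg_right (Real.one_le_exp (abs_nonneg z)) hnonneg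
    linarith
  · have h1 := sq_div_two_le_one_add_sub_one_mul_exp (neg_nonneg.2 h0)
    have h2 : Real.exp (-z) * Real.exp z = 1 := by rw [← Real.exp_add]; simp
    rw [abs_of_nonpos h0]
    linarith

theorem klDiv_eq_sum_mul_exp_sub_one_sub {α : Type*} [Fintype α] {P Q : α → ℝ}
    (hP : ∀ x, 0 < P x) (hQ : ∀ x, 0 < Q x) (hsum : ∑ x, P x = ∑ x, Q x) :
    klDiv Q P = ∑ x, Q x * (Real.exp (Real.log (P x / Q x)) - 1 - Real.log (P x / Q x)) := by
  have hterm (x : α) : Q x * (Real.exp (Real.log (P x / Q x)) - 1 - Real.log (P x / Q x)) =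
      P x - Q x + Q x * Real.log (Q x / P x) := by
    rw [Real.exp_log (div_pos (hP x) (hQ x)), ← inv_div (P x) (Q x), Real.log_inv, mul_sub,
      mul_sub, mul_div_cancel₀ _ (hQ x).ne']
    ring
  simp only [hterm, Finset.sum_add_distrib, Finset.sum_sub_distrib, hsum, sub_self, zero_add, klDiv]

theorem second_moment_llr_le
    {α : Type*} [Fintype α] [Nonempty α]
    (P Q : α → ℝ)
    (hP : ∀ x, 0 < P x) (hPsum : ∑ x, P x = 1)
    (hQ : ∀ x, 0 < Q x) (hQsum : ∑ x, Q x = 1)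
    (B : ℝ) (hB : 0 ≤ B)
    (hbdd : ∀ x, |Real.log (P x / Q x)| ≤ B) :
    ∑ x, Q x * (Real.log (P x / Q x)) ^ 2 ≤ 2 * Real.exp B * klDiv Q P := by
  rw [klDiv_eq_sum_mul_exp_sub_one_sub hP hQ (hPsum.trans hQsum.symm), Finset.mul_sum]
  refine Finset.sum_le_sum fun x _ ↦ ?_
  rw [mul_left_comm]
  exact mul_le_mul_of_nonneg_left (sq_le_two_mul_exp_mul_exp_sub_one_sub (hbdd x)) (hQ x).le
end

section
/- Suppose |log(P x / Q x)| ≤ B for all x ∈ α and |log(V y / U y)| ≤ B for all y ∈ β, where B ≥ 0. Then for every t ∈ [−1, 1], ψ_{QU}(t) ≤ (m₁·D(Q‖P) + m₂·D(U‖V))·(−t + e^{5B}·t²). -/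
/-- Second-order Taylor expansion of `exp` at `0` with Lagrange remainder. -/
lemma exists_exp_eq_quadratic (x : ℝ) :
    ∃ ξ, |ξ| ≤ |x| ∧ Real.exp x = 1 + x + Real.exp ξ * x ^ 2 / 2 := by
  rcases eq_or_ne 0 x with rfl | hx
  · exact ⟨0, le_rfl, by simp⟩
  · obtain ⟨ξ, hξ, h⟩ := taylor_mean_remainder_lagrange_iteratedDeriv (f := Real.exp) (n := 1) hx
      Real.contDiff_exp.contDiffOn
    have hd : derivWithin Real.exp (Set.uIcc 0 x) 0 = 1 := by
      rw [Real.differentiableAt_exp.derivWithin (uniqueDiffOn_uIcc hx 0 Set.left_mem_uIcc)]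
      simp
    rw [taylorWithinEval_succ, taylor_within_zero_eval, iteratedDerivWithin_one, hd,
      iteratedDeriv_eq_iterate, Real.iter_deriv_exp] at h
    norm_num at h
    refine ⟨ξ, ?_, by linarith⟩
    simpa using Set.abs_sub_left_of_mem_uIcc (Set.Ioo_subset_Icc_self hξ)

lemma exp_le_quadratic {x B : ℝ} (hx : |x| ≤ B) :
    Real.exp x ≤ 1 + x + Real.exp B * x ^ 2 / 2 := by
  obtain ⟨ξ, hξ, h⟩ := exists_exp_eq_quadratic x
  have : Real.exp ξ ≤ Real.exp B := Real.exp_le_exp.2 ((le_abs_self ξ).trans (hξ.trans hx))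
  rw [h]
  gcongr

lemma quadratic_le_exp {x B : ℝ} (hx : |x| ≤ B) :
    1 + x + Real.exp (-B) * x ^ 2 / 2 ≤ Real.exp x := by
  obtain ⟨ξ, hξ, h⟩ := exists_exp_eq_quadratic x
  have : Real.exp (-B) ≤ Real.exp ξ :=
    Real.exp_le_exp.2 ((neg_le_neg (hξ.trans hx)).trans (neg_abs_le ξ))
  rw [h]
  gcongr

lemma klDiv_eq_neg_sum {α : Type*} [Fintype α] (P Q : α → ℝ) :
    klDiv Q P = -∑ x, Q x * Real.log (P x / Q x) := by
  rw [klDiv, ← Finset.sum_neg_distrib]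
  refine Finset.sum_congr rfl fun x _ => ?_
  rw [← inv_div (P x) (Q x), Real.log_inv, mul_neg]

/-- The second moment of a bounded log-likelihood ratio is controlled by the KL divergence. -/
lemma sum_mul_log_sq_le_klDiv {α : Type*} [Fintype α] {P Q : α → ℝ}
    (hP : ∀ x, 0 < P x) (hPsum : ∑ x, P x = 1) (hQ : ∀ x, 0 < Q x) (hQsum : ∑ x, Q x = 1)
    {B : ℝ} (hB : ∀ x, |Real.log (P x / Q x)| ≤ B) :
    ∑ x, Q x * Real.log (P x / Q x) ^ 2 ≤ 2 * Real.exp B * klDiv Q P := by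
  have h : ∑ x, Q x * (1 + Real.log (P x / Q x) +
      Real.exp (-B) * Real.log (P x / Q x) ^ 2 / 2) ≤ ∑ x, P x := by
    refine Finset.sum_le_sum fun x _ => ?_
    have h := mul_le_mul_of_nonneg_left (quadratic_le_exp (hB x)) (hQ x).le
    rwa [Real.exp_log (div_pos (hP x) (hQ x)), mul_div_cancel₀ _ (hQ x).ne'] at h
  have e : ∑ x, Q x * (1 + Real.log (P x / Q x) +
      Real.exp (-B) * Real.log (P x / Q x) ^ 2 / 2) =
      1 - klDiv Q P + Real.exp (-B) / 2 * ∑ x, Q x * Real.log (P x / Q x) ^ 2 := by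
    simp only [mul_add, Finset.sum_add_distrib, mul_one, hQsum]
    rw [klDiv_eq_neg_sum, sub_neg_eq_add, Finset.mul_sum]
    exact congrArg _ (Finset.sum_congr rfl fun x _ => by ring)
  rw [e, hPsum] at h
  have h' : Real.exp (-B) / 2 * ∑ x, Q x * Real.log (P x / Q x) ^ 2 ≤ klDiv Q P := by linarith
  have hexp : Real.exp B * Real.exp (-B) = 1 := by simp [← Real.exp_add]
  calc ∑ x, Q x * Real.log (P x / Q x) ^ 2
      = 2 * Real.exp B * (Real.exp (-B) / 2 * ∑ x, Q x * Real.log (P x / Q x) ^ 2) := by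
        linear_combination -(∑ x, Q x * Real.log (P x / Q x) ^ 2) * hexp
    _ ≤ 2 * Real.exp B * klDiv Q P := by gcongr

lemma log_sum_mul_rpow_le {α : Type*} [Fintype α] [Nonempty α] {P Q : α → ℝ}
    (hP : ∀ x, 0 < P x) (hPsum : ∑ x, P x = 1) (hQ : ∀ x, 0 < Q x) (hQsum : ∑ x, Q x = 1)
    {B : ℝ} (hB : ∀ x, |Real.log (P x / Q x)| ≤ B) {t : ℝ} (ht : |t| ≤ 1) :
    Real.log (∑ x, Q x * (P x / Q x) ^ t) ≤ klDiv Q P * (-t + Real.exp (2 * B) * t ^ 2) := by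
  have hr x : 0 < P x / Q x := div_pos (hP x) (hQ x)
  have hpos : 0 < ∑ x, Q x * (P x / Q x) ^ t :=
    Finset.sum_pos (fun x _ => mul_pos (hQ x) (Real.rpow_pos_of_pos (hr x) t))
      Finset.univ_nonempty
  have h : ∑ x, Q x * (P x / Q x) ^ t ≤ ∑ x, Q x * (1 + Real.log (P x / Q x) * t +
      Real.exp B * (Real.log (P x / Q x) * t) ^ 2 / 2) := by
    refine Finset.sum_le_sum fun x _ => mul_le_mul_of_nonneg_left ?_ (hQ x).le
    rw [Real.rpow_def_of_pos (hr x)]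
    refine exp_le_quadratic ?_
    rw [abs_mul]
    exact (mul_le_of_le_one_right (abs_nonneg _) ht).trans (hB x)
  have e : ∑ x, Q x * (1 + Real.log (P x / Q x) * t +
      Real.exp B * (Real.log (P x / Q x) * t) ^ 2 / 2) =
      1 - t * klDiv Q P +
        Real.exp B * t ^ 2 / 2 * ∑ x, Q x * Real.log (P x / Q x) ^ 2 := by
    simp only [mul_add, Finset.sum_add_distrib, mul_one, hQsum]
    rw [klDiv_eq_neg_sum, mul_neg, sub_neg_eq_add, Finset.mul_sum, Finset.mul_sum]
    exact congrArg₂ _ (congrArg _ (Finset.sum_congr rfl fun x _ => by ring))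
      (Finset.sum_congr rfl fun x _ => by ring)
  have hsq : Real.exp B * t ^ 2 / 2 * ∑ x, Q x * Real.log (P x / Q x) ^ 2 ≤
      Real.exp B * t ^ 2 / 2 * (2 * Real.exp B * klDiv Q P) := by
    gcongr
    exact sum_mul_log_sq_le_klDiv hP hPsum hQ hQsum hB
  have hexp : Real.exp (2 * B) = Real.exp B * Real.exp B := by rw [two_mul, Real.exp_add]
  rw [hexp]
  linarith [Real.log_le_sub_one_of_pos hpos]

lemma klDiv_nonneg_of_abs_log_le {α : Type*} [Fintype α] {P Q : α → ℝ}
    (hP : ∀ x, 0 < P x) (hPsum : ∑ x, P x = 1) (hQ : ∀ x, 0 < Q x) (hQsum : ∑ x, Q x = 1)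
    {B : ℝ} (hB : ∀ x, |Real.log (P x / Q x)| ≤ B) : 0 ≤ klDiv Q P :=
  nonneg_of_mul_nonneg_right
    ((Finset.sum_nonneg fun x _ => mul_nonneg (hQ x).le (sq_nonneg _)).trans
      (sum_mul_log_sq_le_klDiv hP hPsum hQ hQsum hB)) (by positivity)

theorem psiQU_quadratic_upper_bound
    {α β : Type*} [Fintype α] [Nonempty α] [Fintype β] [Nonempty β]
    (P Q : α → ℝ) (V U : β → ℝ)
    (hP : ∀ x, 0 < P x) (hPsum : ∑ x, P x = 1)
    (hQ : ∀ x, 0 < Q x) (hQsum : ∑ x, Q x = 1)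
    (hV : ∀ y, 0 < V y) (hVsum : ∑ y, V y = 1)
    (hU : ∀ y, 0 < U y) (hUsum : ∑ y, U y = 1)
    (m₁ m₂ : ℝ) (hm₁ : 0 ≤ m₁) (hm₂ : 0 ≤ m₂)
    (B : ℝ) (hB : 0 ≤ B)
    (hbddG : ∀ x, |Real.log (P x / Q x)| ≤ B)
    (hbddS : ∀ y, |Real.log (V y / U y)| ≤ B)
    (t : ℝ) (ht : t ∈ Set.Icc (-1 : ℝ) 1) :
    psiQU P Q V U m₁ m₂ t ≤
      (m₁ * klDiv Q P + m₂ * klDiv U V) * (-t + Real.exp (5 * B) * t ^ 2) := by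
  have ht' : |t| ≤ 1 := abs_le.2 ht
  have hG := klDiv_nonneg_of_abs_log_le hP hPsum hQ hQsum hbddG
  have hS := klDiv_nonneg_of_abs_log_le hV hVsum hU hUsum hbddS
  calc psiQU P Q V U m₁ m₂ t
      ≤ m₁ * (klDiv Q P * (-t + Real.exp (2 * B) * t ^ 2)) +
          m₂ * (klDiv U V * (-t + Real.exp (2 * B) * t ^ 2)) := by
        unfold psiQU
        gcongr
        · exact log_sum_mul_rpow_le hP hPsum hQ hQsum hbddG ht'
        · exact log_sum_mul_rpow_le hV hVsum hU hUsum hbddS ht'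
    _ = (m₁ * klDiv Q P + m₂ * klDiv U V) * (-t + Real.exp (2 * B) * t ^ 2) := by ring
    _ ≤ (m₁ * klDiv Q P + m₂ * klDiv U V) * (-t + Real.exp (5 * B) * t ^ 2) := by
        gcongr
        norm_num
end

section
/- For all reals ρ > 0, a > b > 0 and all β with 0 < β < ρ·(a − b − b·T), it holds that η₃(ρ,a,b,β) ≥ η₂(ρ,a,b,β). -/
/-- T = log(a/b). -/
noncomputable def Tlog (a b : ℝ) : ℝ := Real.log (a / b)

/-- η₂(ρ,a,b,β) = ρ·b + ((ρ·(a−b) − β)/T)·log((ρ·(a−b) − β)/(ρ·e·b·T)) + β. -/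
noncomputable def eta2 (ρ a b β : ℝ) : ℝ :=
  ρ * b + ((ρ * (a - b) - β) / Tlog a b) *
      Real.log ((ρ * (a - b) - β) / (ρ * Real.exp 1 * b * Tlog a b)) + β

/-- η₃(ρ,a,b,β) = ρ·b + ((ρ·(a−b) + β)/T)·log((ρ·(a−b) + β)/(ρ·e·b·T)). -/
noncomputable def eta3 (ρ a b β : ℝ) : ℝ :=
  ρ * b + ((ρ * (a - b) + β) / Tlog a b) *
      Real.log ((ρ * (a - b) + β) / (ρ * Real.exp 1 * b * Tlog a b))

open Real Set

namespace Eta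

lemma two_mul_exp_ge {T : ℝ} (hT : 0 ≤ T) : 0 ≤ 2 * exp T - 2 - 2 * T - T ^ 2 := by
  linarith [quadratic_le_exp_of_nonneg hT]

lemma sub_two_mul_exp_add_nonneg {T : ℝ} (hT : 0 ≤ T) : 0 ≤ (T - 2) * exp T + T + 2 := by
  have hd (x : ℝ) : HasDerivAt (fun x : ℝ ↦ (x - 2) * exp x + x + 2)
      (1 * exp x + (x - 2) * exp x + 1) x :=
    (((((hasDerivAt_id' x).sub_const 2).mul (hasDerivAt_exp x)).add (hasDerivAt_id' x)).add_const 2)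
  have hmono : MonotoneOn (fun x : ℝ ↦ (x - 2) * exp x + x + 2) (Ici 0) := by
    refine monotoneOn_of_hasDerivWithinAt_nonneg (convex_Ici 0)
      (fun x _ ↦ (hd x).continuousAt.continuousWithinAt)
      (fun x _ ↦ (hd x).hasDerivWithinAt) (fun x _ ↦ ?_)
    have h1 : exp (-x) * exp x = 1 := by rw [← exp_add]; simp
    have h2 := add_one_le_exp (-x)
    nlinarith [exp_pos x]
  have := hmono (mem_Ici.2 le_rfl) (mem_Ici.2 hT) hT
  simpa using this

/-- With `v = 2 (exp T - 1) / T - 1`, this is `log v - (v - 1) (1 + T / 2) / v`. -/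
noncomputable def gap (T : ℝ) : ℝ :=
  log (2 * exp T - 2 - T) - log T - (exp T - 1 - T) * (2 + T) / (2 * exp T - 2 - T)

lemma monotoneOn_gap : MonotoneOn gap (Ioi 0) := by
  have hN {x : ℝ} (hx : x ∈ Ioi (0 : ℝ)) : 0 < 2 * exp x - 2 - x := by
    have := add_one_le_exp x
    have : 0 < x := hx
    linarith
  have hd (x : ℝ) (hx : x ∈ Ioi (0 : ℝ)) : HasDerivAt gap
      ((2 * exp x - 2 - 2 * x - x ^ 2) * ((x - 2) * exp x + x + 2) /
        (x * (2 * exp x - 2 - x) ^ 2)) x := by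
    have hx0 : x ≠ 0 := (mem_Ioi.1 hx).ne'
    have hN0 := (hN hx).ne'
    have e1 : HasDerivAt (fun x : ℝ ↦ 2 * exp x - 2 - x) (2 * exp x - 1) x :=
      (((hasDerivAt_exp x).const_mul 2).sub_const 2).sub (hasDerivAt_id' x)
    have e2 : HasDerivAt (fun x : ℝ ↦ exp x - 1 - x) (exp x - 1) x :=
      ((hasDerivAt_exp x).sub_const 1).sub (hasDerivAt_id' x)
    have e3 : HasDerivAt (fun x : ℝ ↦ 2 + x) 1 x := (hasDerivAt_id' x).const_add 2
    have := ((e1.log hN0).sub (hasDerivAt_log hx0)).sub ((e2.mul e3).div e1 hN0)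
    refine this.congr_deriv ?_
    simp only [Pi.mul_apply]
    generalize hn : 2 * exp x - 2 - x = n at hN0 ⊢
    field_simp
    subst hn
    ring
  refine monotoneOn_of_hasDerivWithinAt_nonneg (convex_Ioi 0)
    (fun x hx ↦ (hd x hx).continuousAt.continuousWithinAt)
    (fun x hx ↦ (hd x (interior_subset hx)).hasDerivWithinAt) (fun x hx ↦ ?_)
  have hx : 0 < x := interior_subset hx
  exact div_nonneg (mul_nonneg (two_mul_exp_ge hx.le) (sub_two_mul_exp_add_nonneg hx.le))
    (by positivity)

lemma neg_le_gap {x : ℝ} (hx : 0 < x) (hx1 : x ≤ 1) : -(3 * x) ≤ gap x := by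
  have h1 := add_one_le_exp x
  have h2 : exp x - 1 - x ≤ x ^ 2 :=
    (le_abs_self _).trans (abs_exp_sub_one_sub_id_le (by rwa [abs_of_pos hx]))
  have hN : x ≤ 2 * exp x - 2 - x := by linarith
  have hlog : log x ≤ log (2 * exp x - 2 - x) := log_le_log hx hN
  have : (exp x - 1 - x) * (2 + x) / (2 * exp x - 2 - x) ≤ 3 * x := by
    rw [div_le_iff₀ (by linarith)]
    nlinarith [mul_nonneg hx.le (sub_nonneg.2 hN), mul_nonneg (sub_nonneg.2 h2) hx.le,
      mul_nonneg (sq_nonneg x) (sub_nonneg.2 hx1)]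
  unfold gap
  linarith

lemma gap_nonneg {T : ℝ} (hT : 0 < T) : 0 ≤ gap T := by
  refine le_of_forall_pos_le_add fun ε hε ↦ ?_
  have hx : 0 < min (min 1 T) (ε / 3) := by positivity
  have h1 := neg_le_gap hx ((min_le_left _ _).trans (min_le_left _ _))
  have h2 := monotoneOn_gap (mem_Ioi.2 hx) (mem_Ioi.2 hT)
    ((min_le_left _ _).trans (min_le_right _ _))
  have h3 : min (min 1 T) (ε / 3) ≤ ε / 3 := min_le_right _ _
  linarith

/-- The scaled difference of `eta3` and `eta2`, with `M = (exp T - 1) / T` and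
`x = β / (ρ b T)`. -/
noncomputable def diff (M T x : ℝ) : ℝ :=
  (M + x) * (log (M + x) - 1) - (M - x) * (log (M - x) - 1) - T * x

lemma concaveOn_diff {M : ℝ} (T : ℝ) (hM : 1 ≤ M) : ConcaveOn ℝ (Icc 0 (M - 1)) (diff M T) := by
  have hd (x : ℝ) (hx : x ∈ Icc 0 (M - 1)) :
      HasDerivAt (diff M T) (log (M + x) + log (M - x) - T) x := by
    have hp : M + x ≠ 0 := (by linarith [hx.1] : 0 < M + x).ne'
    have hm : M - x ≠ 0 := (by linarith [hx.2] : 0 < M - x).ne'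
    have e1 : HasDerivAt (fun x : ℝ ↦ M + x) 1 x := (hasDerivAt_id' x).const_add M
    have e2 : HasDerivAt (fun x : ℝ ↦ M - x) (-1) x := (hasDerivAt_id' x).const_sub M
    have := ((e1.mul ((e1.log hp).sub_const 1)).sub (e2.mul ((e2.log hm).sub_const 1))).sub
      ((hasDerivAt_id' x).const_mul T)
    refine this.congr_deriv ?_
    field_simp
    ring
  refine AntitoneOn.concaveOn_of_deriv (convex_Icc _ _)
    (fun x hx ↦ (hd x hx).continuousAt.continuousWithinAt)
    (fun x hx ↦ (hd x (interior_subset hx)).differentiableAt.differentiableWithinAt) ?_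
  intro x hx y hy hxy
  have hx := interior_subset hx
  have hy := interior_subset hy
  have hpos {z : ℝ} (hz : z ∈ Icc 0 (M - 1)) : 0 < M + z ∧ 0 < M - z :=
    ⟨by linarith [hz.1], by linarith [hz.2]⟩
  rw [(hd x hx).deriv, (hd y hy).deriv, ← log_mul (hpos hx).1.ne' (hpos hx).2.ne',
    ← log_mul (hpos hy).1.ne' (hpos hy).2.ne']
  have : log ((M + y) * (M - y)) ≤ log ((M + x) * (M - x)) := by
    refine log_le_log (mul_pos (hpos hy).1 (hpos hy).2) ?_
    nlinarith [hx.1]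
  linarith

lemma diff_endpoint_nonneg {M T : ℝ} (hT : 0 < T) (hM : T * M = exp T - 1) :
    0 ≤ diff M T (M - 1) := by
  have hexp : exp T = T * M + 1 := by linarith
  have hM1 : 1 ≤ M := by nlinarith [add_one_le_exp T]
  have hv : 0 < 2 * M - 1 := by linarith
  have h := gap_nonneg hT
  have hN : 2 * exp T - 2 - T = (2 * M - 1) * T := by rw [hexp]; ring
  have hA : exp T - 1 - T = (M - 1) * T := by rw [hexp]; ring
  rw [gap, hN, hA, log_mul hv.ne' hT.ne',
    show (M - 1) * T * (2 + T) / ((2 * M - 1) * T) = (M - 1) * (2 + T) / (2 * M - 1) by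
      field_simp] at h
  have h' : (M - 1) * (2 + T) / (2 * M - 1) ≤ log (2 * M - 1) := by linarith
  rw [div_le_iff₀ hv] at h'
  rw [diff, show M + (M - 1) = 2 * M - 1 by ring, show M - (M - 1) = 1 by ring, log_one]
  linarith

lemma diff_nonneg {M T x : ℝ} (hT : 0 < T) (hM : T * M = exp T - 1) (hx : 0 ≤ x)
    (hxM : x ≤ M - 1) : 0 ≤ diff M T x := by
  have hM1 : 0 ≤ M - 1 := hx.trans hxM
  have h := (concaveOn_diff T (sub_nonneg.1 hM1)).min_le_of_mem_Icc
    (left_mem_Icc.2 hM1) (right_mem_Icc.2 hM1) ⟨hx, hxM⟩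
  have h0 : diff M T 0 = 0 := by simp [diff]
  exact (le_min h0.ge (diff_endpoint_nonneg hT hM)).trans h

lemma eta3_sub_eta2 {ρ a b β T M x : ℝ} (hT : T = Tlog a b) (hT0 : T ≠ 0) (hρ : ρ ≠ 0)
    (hb : b ≠ 0) (hM : ρ * (a - b) = ρ * b * T * M) (hx : β = ρ * b * T * x)
    (hp : M + x ≠ 0) (hm : M - x ≠ 0) :
    eta3 ρ a b β - eta2 ρ a b β = ρ * b * diff M T x := by
  have key {y : ℝ} (hy : y ≠ 0) :
      log (ρ * b * T * y / (ρ * exp 1 * b * T)) = log y - 1 := by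
    rw [show ρ * b * T * y / (ρ * exp 1 * b * T) = y / exp 1 by field_simp,
      log_div hy (exp_ne_zero 1), log_exp]
  rw [eta3, eta2, ← hT, hM, hx, ← mul_add, ← mul_sub, key hp, key hm, diff]
  field_simp
  ring

end Eta

theorem eta3_ge_eta2 (ρ a b β : ℝ) (hρ : 0 < ρ) (hb : 0 < b) (hab : b < a)
    (hβ : 0 < β) (hβ' : β < ρ * (a - b - b * Tlog a b)) :
    eta2 ρ a b β ≤ eta3 ρ a b β := by
  obtain ⟨T, hT⟩ : ∃ T, T = Tlog a b := ⟨_, rfl⟩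
  have hT0 : 0 < T := hT ▸ log_pos ((one_lt_div hb).2 hab)
  have hexp : exp T = a / b := by rw [hT, Tlog, exp_log (div_pos (hb.trans hab) hb)]
  have hc : 0 < ρ * b * T := by positivity
  have hM : T * ((exp T - 1) / T) = exp T - 1 := by field_simp
  have hD : ρ * (a - b) = ρ * b * T * ((exp T - 1) / T) := by
    rw [hexp]; field_simp
  have hx0 : 0 < β / (ρ * b * T) := by positivity
  have hxM : β / (ρ * b * T) ≤ (exp T - 1) / T - 1 := by
    rw [div_le_iff₀ hc]
    rw [← hT] at hβ'
    linarith
  have h := Eta.eta3_sub_eta2 hT hT0.ne' hρ.ne' hb.ne' hD (mul_div_cancel₀ β hc.ne').symm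
    (by linarith : 0 < (exp T - 1) / T + β / (ρ * b * T)).ne'
    (by linarith : 0 < (exp T - 1) / T - β / (ρ * b * T)).ne'
  have hnonneg := mul_nonneg (mul_pos hρ hb).le (Eta.diff_nonneg hT0 hM hx0.le hxM)
  linarith
end

section
/- For all reals ρ > 0, a > b > 0 and all β > 0, it holds that η₃(ρ,a,b,β) ≥ β. -/
theorem eta3_ge_beta (ρ a b β : ℝ) (hρ : 0 < ρ) (hb : 0 < b) (hab : b < a)
    (hβ : 0 < β) :
    β ≤ eta3 ρ a b β := by
  have ha : 0 < a := hb.trans hab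
  have hT : 0 < Tlog a b := Real.log_pos ((one_lt_div hb).2 hab)
  have hX : 0 < ρ * (a - b) + β := by
    have := mul_pos hρ (sub_pos.2 hab)
    linarith
  have hTdef : Real.log (a / b) = Tlog a b := rfl
  unfold eta3
  generalize Tlog a b = T at hT hTdef ⊢
  obtain ⟨X, hXdef⟩ : ∃ X, X = ρ * (a - b) + β := ⟨_, rfl⟩
  rw [← hXdef] at hX ⊢
  have hlog : Real.log (X / (ρ * Real.exp 1 * b * T)) =
      Real.log (X / (ρ * a * T)) + T - 1 := by
    have hsplit : X / (ρ * Real.exp 1 * b * T) = X / (ρ * a * T) * (a / b) / Real.exp 1 := by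
      field_simp
    rw [hsplit, Real.log_div (by positivity) (by positivity),
      Real.log_mul (by positivity) (by positivity), hTdef, Real.log_exp]
  have hy : 0 < X / (ρ * a * T) := by positivity
  have hkey := mul_le_mul_of_nonneg_left (Real.one_sub_inv_le_log_of_pos hy)
    (div_pos hX hT).le
  have hleft : X / T * (1 - (X / (ρ * a * T))⁻¹) = X / T - ρ * a := by
    field_simp
  have hcancel : X / T * T = X := div_mul_cancel₀ X hT.ne'
  rw [hlog]
  linarith
end

section
/- For all reals c > 0 and a > b > 0, with T = log(a/b), the supremum over t ∈ [0,1] of the function t ↦ t·c·(a−b) + c·b − c·b·(a/b)^t equals c·(b + ((a−b)/T)·log((a−b)/(e·b·T))). In particular, the supremum is attained at t* = (1/T)·log((a−b)/(b·T)), which lies in [0,1]. -/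
theorem sup_exact_recovery_exponent (c a b : ℝ) (hc : 0 < c) (hb : 0 < b) (hab : b < a) :
    sSup ((fun t : ℝ => t * c * (a - b) + c * b - c * b * (a / b) ^ t) '' Set.Icc 0 1) =
        c * (b + ((a - b) / Real.log (a / b)) *
          Real.log ((a - b) / (Real.exp 1 * b * Real.log (a / b)))) ∧
      (1 / Real.log (a / b)) * Real.log ((a - b) / (b * Real.log (a / b))) ∈
        Set.Icc (0 : ℝ) 1 ∧
      (fun t : ℝ => t * c * (a - b) + c * b - c * b * (a / b) ^ t)
          ((1 / Real.log (a / b)) * Real.log ((a - b) / (b * Real.log (a / b)))) =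
        c * (b + ((a - b) / Real.log (a / b)) *
          Real.log ((a - b) / (Real.exp 1 * b * Real.log (a / b)))) := by
  have ha : 0 < a := hb.trans hab
  have hr : 0 < a / b := div_pos ha hb
  have hT : 0 < Real.log (a / b) := Real.log_pos ((one_lt_div hb).2 hab)
  have hupper : Real.log (a / b) ≤ a / b - 1 := Real.log_le_sub_one_of_pos hr
  have hlower : 1 - (a / b)⁻¹ ≤ Real.log (a / b) := Real.one_sub_inv_le_log_of_pos hr
  have hpow : ∀ t : ℝ, (a / b) ^ t = Real.exp (Real.log (a / b) * t) :=
    Real.rpow_def_of_pos hr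
  have hR : 0 < (a - b) / (b * Real.log (a / b)) :=
    div_pos (sub_pos.2 hab) (mul_pos hb hT)
  have hlog : Real.log ((a - b) / (Real.exp 1 * b * Real.log (a / b))) =
      Real.log ((a - b) / (b * Real.log (a / b))) - 1 := by
    rw [mul_assoc, mul_comm (Real.exp 1), ← div_div,
      Real.log_div hR.ne' (Real.exp_pos 1).ne', Real.log_exp]
  have hmem : (1 / Real.log (a / b)) * Real.log ((a - b) / (b * Real.log (a / b))) ∈
      Set.Icc (0 : ℝ) 1 := by
    have hone : 1 ≤ (a - b) / (b * Real.log (a / b)) := by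
      rw [one_le_div (mul_pos hb hT)]
      calc b * Real.log (a / b) ≤ b * (a / b - 1) := by gcongr
        _ = a - b := by field_simp
    have hratio : (a - b) / (b * Real.log (a / b)) ≤ a / b := by
      rw [div_le_div_iff₀ (mul_pos hb hT) hb]
      calc (a - b) * b = a * b * (1 - (a / b)⁻¹) := by field_simp
        _ ≤ a * b * Real.log (a / b) := by gcongr
        _ = a * (b * Real.log (a / b)) := by ring
    rw [one_div_mul_eq_div]
    exact ⟨div_nonneg (Real.log_nonneg hone) hT.le,
      (div_le_one hT).2 (Real.log_le_log hR hratio)⟩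
  have hexp := Real.exp_log hR
  rw [hlog]
  simp only [hpow]
  generalize Real.log ((a - b) / (b * Real.log (a / b))) = L at *
  generalize Real.log (a / b) = T at *
  have hvalue : 1 / T * L * c * (a - b) + c * b - c * b * Real.exp (T * (1 / T * L)) =
      c * (b + (a - b) / T * (L - 1)) := by
    rw [show T * (1 / T * L) = L by field_simp, hexp]
    field_simp
    ring
  refine ⟨IsGreatest.csSup_eq ⟨⟨_, hmem, hvalue⟩, ?_⟩, hmem, hvalue⟩
  rintro _ ⟨t, -, rfl⟩
  have htangent : (a - b) / (b * T) * (T * t - L + 1) ≤ Real.exp (T * t) := by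
    calc (a - b) / (b * T) * (T * t - L + 1)
        ≤ (a - b) / (b * T) * Real.exp (T * t - L) := by
          gcongr
          exact Real.add_one_le_exp _
      _ = Real.exp (T * t) := by rw [← hexp, ← Real.exp_add, add_sub_cancel]
  calc t * c * (a - b) + c * b - c * b * Real.exp (T * t)
      ≤ t * c * (a - b) + c * b - c * b * ((a - b) / (b * T) * (T * t - L + 1)) := by
        gcongr
    _ = c * (b + (a - b) / T * (L - 1)) := by
        field_simp
        ring
end

section
/- For all reals ρ > 0, a > b > 0, with T = log(a/b), and every β with 0 ≤ β ≤ ρ·(a − b − b·T), the supremum over t ∈ [0,1] of the function t ↦ t·(ρ·(a−b) − β) + ρ·b − ρ·b·(a/b)^t equals ρ·b + ((ρ·(a−b) − β)/T)·log((ρ·(a−b) − β)/(ρ·e·b·T)). -/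
/-- The concave function `t ↦ t * C - K * exp (T * t)` attains its global maximum at the
critical point `t = log (C / (K * T)) / T`. -/
theorem mul_sub_mul_exp_le {C K T : ℝ} (hC : 0 < C) (hK : 0 < K) (hT : 0 < T) (t : ℝ) :
    t * C - K * Real.exp (T * t) ≤ C / T * (Real.log (C / (K * T)) - 1) := by
  set L := Real.log (C / (K * T)) with hL
  have hexp : Real.exp (T * t) = C / (K * T) * Real.exp (T * t - L) := by
    rw [Real.exp_sub, hL, Real.exp_log (by positivity)]
    field_simp
  have hscale : K * Real.exp (T * t) = C / T * Real.exp (T * t - L) := by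
    rw [hexp]
    field_simp
  have hbound : C / T * (T * t - L + 1) ≤ C / T * Real.exp (T * t - L) :=
    mul_le_mul_of_nonneg_left (Real.add_one_le_exp _) (by positivity)
  have htC : t * C = C / T * (T * t) := by field_simp
  rw [hscale, htC]
  linarith

theorem sup_exact_recovery_exponent_shifted (ρ a b β : ℝ)
    (hρ : 0 < ρ) (hb : 0 < b) (hab : b < a)
    (hβ0 : 0 ≤ β) (hβ1 : β ≤ ρ * (a - b - b * Real.log (a / b))) :
    sSup ((fun t : ℝ => t * (ρ * (a - b) - β) + ρ * b - ρ * b * (a / b) ^ t) ''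
        Set.Icc 0 1) =
      ρ * b + ((ρ * (a - b) - β) / Real.log (a / b)) *
        Real.log ((ρ * (a - b) - β) / (ρ * Real.exp 1 * b * Real.log (a / b))) := by
  have ha : 0 < a := hb.trans hab
  have hq : 0 < a / b := by positivity
  have hT : 0 < Real.log (a / b) := Real.log_pos ((one_lt_div hb).2 hab)
  have hexpT : Real.exp (Real.log (a / b)) = a / b := Real.exp_log hq
  have hTa : a - b ≤ a * Real.log (a / b) := by
    have h := mul_le_mul_of_nonneg_left (Real.one_sub_inv_le_log_of_pos hq) ha.le
    have h' : a * (1 - (a / b)⁻¹) = a - b := by field_simp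
    linarith
  have hpow (t : ℝ) : (a / b) ^ t = Real.exp (Real.log (a / b) * t) :=
    Real.rpow_def_of_pos hq t
  simp only [hpow]
  set T := Real.log (a / b)
  have hK : 0 < ρ * b := by positivity
  have hlower : ρ * b * T ≤ ρ * (a - b) - β := by linarith
  have hupper : ρ * (a - b) - β ≤ ρ * a * T := by
    have h := mul_le_mul_of_nonneg_left hTa hρ.le
    linarith
  set C := ρ * (a - b) - β
  have hC : 0 < C := lt_of_lt_of_le (by positivity) hlower
  have hlog : Real.log (C / (ρ * Real.exp 1 * b * T)) = Real.log (C / (ρ * b * T)) - 1 := by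
    rw [show C / (ρ * Real.exp 1 * b * T) = C / (ρ * b * T) / Real.exp 1 by field_simp,
      Real.log_div (by positivity) (by positivity), Real.log_exp]
  rw [hlog]
  refine IsGreatest.csSup_eq ⟨⟨Real.log (C / (ρ * b * T)) / T, ⟨?_, ?_⟩, ?_⟩, ?_⟩
  · exact div_nonneg (Real.log_nonneg ((one_le_div (by positivity)).2 hlower)) hT.le
  · rw [div_le_one hT, Real.log_le_iff_le_exp (by positivity), hexpT,
      div_le_div_iff₀ (by positivity) hb]
    have h := mul_le_mul_of_nonneg_right hupper hb.le
    linarith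
  · simp only
    rw [mul_div_cancel₀ _ hT.ne', Real.exp_log (by positivity)]
    field_simp
    ring
  · rintro _ ⟨t, -, rfl⟩
    have h := mul_sub_mul_exp_le hC hK hT t
    simp only
    linarith
end

section
/- Let n ≥ 1 and let X₁, …, Xₙ be i.i.d. random variables, each equal to f(Y) where Y is distributed on the finite type α according to the positive pmf μ and f : α → ℝ. Let S = X₁ + ⋯ + Xₙ, let M(t) = ∑_x μ(x)·e^{t·f(x)} and Γ(t) = log M(t). Suppose t* ∈ ℝ satisfies the first-order condition n·(∑_x f(x)·e^{t*·f(x)}·μ(x))/M(t*) = a for a given real a. Let μ̂ be the tilted pmf μ̂(x) = e^{t*·f(x)}·μ(x)/M(t*), and let σ̂² = ∑_x μ̂(x)·f(x)² − (∑_x μ̂(x)·f(x))² be its variance. Then for every ε > 0, ℙ(S ≥ a − ε) ≥ exp(−(t*·a − n·Γ(t*) + |t*|·ε))·(1 − n·σ̂²/ε²). -/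
/-- A sum over sequences of length `n + 1` splits into a sum over the head and the tail. -/
theorem sum_fin_succ_arrow {α : Type*} [Fintype α] (n : ℕ) (F : (Fin (n + 1) → α) → ℝ) :
    ∑ ω, F ω = ∑ x, ∑ ω : Fin n → α, F (Fin.cons x ω) := by
  rw [← Fintype.sum_prod_type']
  exact ((Fin.consEquiv fun _ => α).sum_comp F).symm

/-- Total mass of a finite product of weights of total mass one. -/
theorem sum_prod_eq_one {α : Type*} [Fintype α] (ν : α → ℝ) (hν : ∑ x, ν x = 1) (n : ℕ) :
    ∑ ω : Fin n → α, ∏ i, ν (ω i) = 1 := by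
  induction n with
  | zero => simp
  | succ n ih =>
    rw [sum_fin_succ_arrow]
    simp [Fin.prod_univ_succ, ← Finset.mul_sum, ih, hν]

/-- The sum of i.i.d. centred variables is centred. -/
theorem sum_prod_mul_sum_eq_zero {α : Type*} [Fintype α] (ν : α → ℝ) (hν : ∑ x, ν x = 1)
    (g : α → ℝ) (hg : ∑ x, ν x * g x = 0) (n : ℕ) :
    ∑ ω : Fin n → α, (∏ i, ν (ω i)) * ∑ i, g (ω i) = 0 := by
  induction n with
  | zero => simp
  | succ n ih =>
    rw [sum_fin_succ_arrow]
    have h (x : α) : ∑ ω : Fin n → α, (∏ i, ν ((Fin.cons x ω : Fin (n + 1) → α) i)) *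
        ∑ i, g ((Fin.cons x ω : Fin (n + 1) → α) i) = ν x * g x := by
      calc
        _ = ∑ ω : Fin n → α, (ν x * g x * (∏ i, ν (ω i)) +
            ν x * ((∏ i, ν (ω i)) * ∑ i, g (ω i))) := by
          refine Finset.sum_congr rfl fun ω _ => ?_
          simp only [Fin.prod_univ_succ, Fin.sum_univ_succ, Fin.cons_zero, Fin.cons_succ]
          ring
        _ = ν x * g x := by
          rw [Finset.sum_add_distrib, ← Finset.mul_sum, ← Finset.mul_sum, ih,
            sum_prod_eq_one ν hν]
          ring
    simp_rw [h, hg]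

/-- The variance of a sum of i.i.d. centred variables is additive. -/
theorem sum_prod_mul_sum_sq {α : Type*} [Fintype α] (ν : α → ℝ) (hν : ∑ x, ν x = 1)
    (g : α → ℝ) (hg : ∑ x, ν x * g x = 0) (n : ℕ) :
    ∑ ω : Fin n → α, (∏ i, ν (ω i)) * (∑ i, g (ω i)) ^ 2 = n * ∑ x, ν x * g x ^ 2 := by
  induction n with
  | zero => simp
  | succ n ih =>
    rw [sum_fin_succ_arrow]
    have h (x : α) : ∑ ω : Fin n → α, (∏ i, ν ((Fin.cons x ω : Fin (n + 1) → α) i)) *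
        (∑ i, g ((Fin.cons x ω : Fin (n + 1) → α) i)) ^ 2 =
        ν x * g x ^ 2 + ν x * (n * ∑ y, ν y * g y ^ 2) := by
      calc
        _ = ∑ ω : Fin n → α, (ν x * g x ^ 2 * (∏ i, ν (ω i)) +
            2 * ν x * g x * ((∏ i, ν (ω i)) * ∑ i, g (ω i)) +
            ν x * ((∏ i, ν (ω i)) * (∑ i, g (ω i)) ^ 2)) := by
          refine Finset.sum_congr rfl fun ω _ => ?_
          simp only [Fin.prod_univ_succ, Fin.sum_univ_succ, Fin.cons_zero, Fin.cons_succ]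
          ring
        _ = _ := by
          rw [Finset.sum_add_distrib, Finset.sum_add_distrib, ← Finset.mul_sum,
            ← Finset.mul_sum, ← Finset.mul_sum, ih, sum_prod_eq_one ν hν,
            sum_prod_mul_sum_eq_zero ν hν g hg]
          ring
    simp_rw [h]
    rw [Finset.sum_add_distrib, ← Finset.sum_mul, hν]
    push_cast
    ring


open Classical in
/-- Lower bound on a lower-tail/large-deviations probability for an i.i.d. sum on a finite
alphabet, via exponential tilting and Chebyshev's inequality.  The probability
`ℙ(S ≥ a − ε)` is written as the finite sum, over outcome sequences `ω : Fin n → α` whose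
sum `∑ i, f (ω i)` is at least `a − ε`, of the product probability `∏ i, μ (ω i)`. -/
theorem tilted_lower_bound
    {α : Type*} [Fintype α] [Nonempty α] (n : ℕ) (hn : 1 ≤ n)
    (μ : α → ℝ) (hμpos : ∀ x, 0 < μ x) (hμsum : ∑ x, μ x = 1)
    (f : α → ℝ) (a tstar : ℝ)
    (hFOC : (n : ℝ) * (∑ x, f x * Real.exp (tstar * f x) * μ x) /
        (∑ x, μ x * Real.exp (tstar * f x)) = a)
    (ε : ℝ) (hε : 0 < ε) :
    Real.exp (-(tstar * a - (n : ℝ) * Real.log (∑ x, μ x * Real.exp (tstar * f x)) +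
          |tstar| * ε)) *
        (1 - (n : ℝ) *
            ((∑ x, (Real.exp (tstar * f x) * μ x / (∑ y, μ y * Real.exp (tstar * f y))) *
                f x ^ 2) -
              (∑ x, (Real.exp (tstar * f x) * μ x / (∑ y, μ y * Real.exp (tstar * f y))) *
                f x) ^ 2) / ε ^ 2) ≤
      ∑ ω ∈ Finset.univ.filter (fun ω : Fin n → α => a - ε ≤ ∑ i, f (ω i)),
        ∏ i, μ (ω i) := by
  set M := ∑ x, μ x * Real.exp (tstar * f x) with hM
  have hMpos : 0 < M :=
    Finset.sum_pos (fun x _ => mul_pos (hμpos x) (Real.exp_pos _)) Finset.univ_nonempty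
  set ν : α → ℝ := fun x => Real.exp (tstar * f x) * μ x / M with hνdef
  have hνnonneg (x : α) : 0 ≤ ν x := by
    have := hμpos x
    positivity
  have hν : ∑ x, ν x = 1 := by
    rw [hνdef, ← Finset.sum_div, div_eq_one_iff_eq hMpos.ne', hM]
    exact Finset.sum_congr rfl fun x _ => mul_comm _ _
  set m := ∑ x, ν x * f x with hm
  have hnm : (n : ℝ) * m = a := by
    rw [← hFOC, mul_div_assoc, hm, Finset.sum_div]
    congr 1
    refine Finset.sum_congr rfl fun x _ => ?_
    simp only [hνdef]
    ring
  have hcentred : ∑ x, ν x * (f x - m) = 0 := by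
    simp_rw [mul_sub]
    rw [Finset.sum_sub_distrib, ← Finset.sum_mul, hν, ← hm]
    ring
  have hvar : ∑ x, ν x * (f x - m) ^ 2 = ∑ x, ν x * f x ^ 2 - m ^ 2 := by
    calc
      _ = ∑ x, (ν x * f x ^ 2 - 2 * m * (ν x * f x) + m ^ 2 * ν x) :=
        Finset.sum_congr rfl fun x _ => by ring
      _ = _ := by
        rw [Finset.sum_add_distrib, Finset.sum_sub_distrib, ← Finset.mul_sum,
          ← Finset.mul_sum, hν, ← hm]
        ring
  have hsum (ω : Fin n → α) : ∑ i, (f (ω i) - m) = ∑ i, f (ω i) - a := by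
    simp [Finset.sum_sub_distrib, hnm]
  set C := Real.exp (-(tstar * a - (n : ℝ) * Real.log M + |tstar| * ε)) with hC
  have hprod (ω : Fin n → α) : ∏ i, μ (ω i) =
      Real.exp (n * Real.log M - tstar * ∑ i, f (ω i)) * ∏ i, ν (ω i) := by
    have hpow : Real.exp (n * Real.log M) = M ^ n := by
      rw [Real.exp_nat_mul, Real.exp_log hMpos]
    simp only [hνdef]
    rw [Finset.prod_div_distrib, Finset.prod_mul_distrib, ← Real.exp_sum, ← Finset.mul_sum,
      Real.exp_sub, hpow]
    simp only [Finset.prod_const, Finset.card_univ, Fintype.card_fin]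
    field_simp
  calc
    C * (1 - (n : ℝ) * (∑ x, ν x * f x ^ 2 - m ^ 2) / ε ^ 2)
      = ∑ ω : Fin n → α, C * ((∏ i, ν (ω i)) * (1 - (∑ i, f (ω i) - a) ^ 2 / ε ^ 2)) := by
        have h := sum_prod_mul_sum_sq ν hν (fun x => f x - m) hcentred n
        simp only [hsum, hvar] at h
        rw [← Finset.mul_sum, ← h]
        congr 1
        simp_rw [mul_sub, mul_one, ← mul_div_assoc]
        rw [Finset.sum_sub_distrib, sum_prod_eq_one ν hν, Finset.sum_div]
    _ ≤ ∑ ω : Fin n → α, if a - ε ≤ ∑ i, f (ω i) then ∏ i, μ (ω i) else 0 := by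
        refine Finset.sum_le_sum fun ω _ => ?_
        have hp : 0 ≤ ∏ i, ν (ω i) := Finset.prod_nonneg fun i _ => hνnonneg _
        have hCpos : 0 < C := Real.exp_pos _
        rcases le_or_gt ε |∑ i, f (ω i) - a| with hfar | hnear
        · have hle : 1 - (∑ i, f (ω i) - a) ^ 2 / ε ^ 2 ≤ 0 := by
            rw [sub_nonpos, one_le_div (by positivity), ← sq_abs (∑ i, f (ω i) - a)]
            gcongr
          refine (mul_nonpos_of_nonneg_of_nonpos hCpos.le
            (mul_nonpos_of_nonneg_of_nonpos hp hle)).trans ?_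
          split_ifs
          · exact Finset.prod_nonneg fun i _ => (hμpos _).le
          · exact le_rfl
        · rw [if_pos (by linarith [neg_lt_of_abs_lt hnear]), hprod]
          have hexp : C ≤ Real.exp (n * Real.log M - tstar * ∑ i, f (ω i)) := by
            rw [hC, Real.exp_le_exp]
            have h := (le_abs_self (tstar * (∑ i, f (ω i) - a))).trans_eq (abs_mul _ _)
            have h' := mul_le_mul_of_nonneg_left hnear.le (abs_nonneg tstar)
            linarith
          have hle : 1 - (∑ i, f (ω i) - a) ^ 2 / ε ^ 2 ≤ 1 := by
            have : 0 ≤ (∑ i, f (ω i) - a) ^ 2 / ε ^ 2 := by positivity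
            linarith
          exact (mul_le_mul_of_nonneg_left (mul_le_of_le_one_right hp hle) hCpos.le).trans
            (mul_le_mul_of_nonneg_right hexp hp)
    _ = _ := (Finset.sum_filter _ _).symm
end

section
/- Let U and V be positive pmfs on the finite type α. Then for every real t ≥ 0, ∑_x V x · (U x / V x)^t ≤ ∑_x U x · (U x / V x)^t. -/
theorem tilted_sum_monotone
    {α : Type*} [Fintype α] [Nonempty α]
    (U V : α → ℝ)
    (hU : ∀ x, 0 < U x) (hUsum : ∑ x, U x = 1)
    (hV : ∀ x, 0 < V x) (hVsum : ∑ x, V x = 1)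
    (t : ℝ) (ht : 0 ≤ t) :
    ∑ x, V x * (U x / V x) ^ t ≤ ∑ x, U x * (U x / V x) ^ t := by
  have pointwise : ∀ x, U x - V x ≤ U x * (U x / V x) ^ t - V x * (U x / V x) ^ t := by
    intro x
    rcases le_total (V x) (U x) with h | h
    · have hr : 1 ≤ (U x / V x) ^ t :=
        Real.one_le_rpow ((one_le_div (hV x)).2 h) ht
      nlinarith [mul_nonneg (sub_nonneg.2 h) (sub_nonneg.2 hr)]
    · have hr : (U x / V x) ^ t ≤ 1 :=
        Real.rpow_le_one (div_pos (hU x) (hV x)).le ((div_le_one (hV x)).2 h) ht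
      nlinarith [mul_nonneg (sub_nonneg.2 h) (sub_nonneg.2 hr)]
  have hsum := Finset.sum_le_sum fun x (_ : x ∈ Finset.univ) => pointwise x
  rw [Finset.sum_sub_distrib, Finset.sum_sub_distrib, hUsum, hVsum] at hsum
  linarith
end
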